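/- arXiv:1612.08001 — 2 statements merged into one kernel-verified Lean document; each statement's English description precedes it below -/
import Mathlib

section
/- For each k = 1, …, n the element c_k is central among the generators: c_k h̃_j = h̃_j c_k, c_k Z^j = Z^j c_k, and c_k ∂_j = ∂_j c_k for all j = 1, …, n. -/
open Finset

/-- Ordered product of a family of (commuting) ring elements over a finite set of indices. -/
def oprod {A : Type*} [Monoid A] {n : ℕ} (s : Finset (Fin n)) (f : Fin n → A) : A :=
  ((s.sort (· ≤ ·)).map f).prod

theorem oprod_commute {A : Type*} [Monoid A] {n : ℕ} (s : Finset (Fin n)) (f : Fin n → A)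
    (w : A) (hw : ∀ i ∈ s, Commute w (f i)) : Commute w (oprod s f) := by
  unfold oprod
  apply Commute.list_prod_right
  intro x hx
  simp only [List.mem_map, Finset.mem_sort] at hx
  obtain ⟨i, hi, rfl⟩ := hx
  exact hw i hi

theorem oprod_eq {A : Type*} [Monoid A] {n : ℕ} (s : Finset (Fin n)) (f : Fin n → A)
    (hc : ∀ i j, f i * f j = f j * f i) :
    oprod s f = s.noncommProd f (fun i _ j _ _ => hc i j) := by
  unfold oprod Finset.noncommProd
  have h1 : s.val.map f = (((s.sort (· ≤ ·)).map f : List A) : Multiset A) := by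
    rw [← Multiset.map_coe, Finset.sort_eq]
  simp only [h1, Multiset.noncommProd_coe]

theorem oprod_insert {A : Type*} [Monoid A] {n : ℕ} (s : Finset (Fin n)) (f : Fin n → A)
    (hc : ∀ i j, f i * f j = f j * f i) (a : Fin n) (ha : a ∉ s) :
    oprod (insert a s) f = f a * oprod s f := by
  rw [oprod_eq _ _ hc, oprod_eq _ _ hc]
  exact Finset.noncommProd_insert_of_notMem _ _ _ _ ha

/-- elementary symmetric function on a subset -/
def EE {A : Type*} [Ring A] {n : ℕ} (h : Fin n → A) (s : Finset (Fin n)) (m : ℕ) : A :=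
  ∑ t ∈ s.powersetCard m, oprod t h

/-- shifted elementary symmetric function -/
def FF {A : Type*} [Ring A] {n : ℕ} (h : Fin n → A) (s : Finset (Fin n)) (m : ℕ) : A :=
  if m = 0 then 0 else EE h s (m - 1)

theorem EE_commute {A : Type*} [Ring A] {n : ℕ} (h : Fin n → A) (s : Finset (Fin n)) (m : ℕ)
    (w : A) (hw : ∀ i ∈ s, Commute w (h i)) : Commute w (EE h s m) := by
  unfold EE
  apply Commute.sum_right
  intro t ht
  exact oprod_commute _ _ _ fun i hi => hw i ((Finset.mem_powersetCard.1 ht).1 hi)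

theorem FF_commute {A : Type*} [Ring A] {n : ℕ} (h : Fin n → A) (s : Finset (Fin n)) (m : ℕ)
    (w : A) (hw : ∀ i ∈ s, Commute w (h i)) : Commute w (FF h s m) := by
  unfold FF
  split_ifs
  · exact Commute.zero_right _
  · exact EE_commute _ _ _ _ hw

theorem EE_insert {A : Type*} [Ring A] {n : ℕ} (h : Fin n → A)
    (hc : ∀ i j, h i * h j = h j * h i) (s : Finset (Fin n)) (a : Fin n) (ha : a ∉ s) (m : ℕ) :
    EE h (insert a s) m = EE h s m + h a * FF h s m := by
  unfold FF
  cases m with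
  | zero => simp [EE]
  | succ m =>
    simp only [EE, Nat.add_sub_cancel, Nat.succ_ne_zero, if_false]
    rw [Finset.powersetCard_succ_insert ha, Finset.sum_union, Finset.sum_image, Finset.mul_sum]
    · congr 1
      apply Finset.sum_congr rfl
      intro t ht
      exact oprod_insert _ _ hc _ fun h' => ha ((Finset.mem_powersetCard.1 ht).1 h')
    · intro t ht t' ht' he
      have e1 : a ∉ t := fun h' => ha ((Finset.mem_powersetCard.1 ht).1 h')
      have e2 : a ∉ t' := fun h' => ha ((Finset.mem_powersetCard.1 ht').1 h')
      rw [← Finset.erase_insert e1, ← Finset.erase_insert e2, he]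
    · rw [Finset.disjoint_left]
      intro t ht ht'
      obtain ⟨u, _, rfl⟩ := Finset.mem_image.1 ht'
      exact ha ((Finset.mem_powersetCard.1 ht).1 (Finset.mem_insert_self _ _))

/-- Abstract commutation lemma. -/
theorem central_aux {A : Type*} [Ring A] {n : ℕ} (i : Fin n) (W e d : A)
    (G P Q x y : Fin n → A) (hd : ∀ a, d * a = a * d)
    (hPQ : ∀ j, j ≠ i → P j - P i = x j * Q j)
    (hxQ : ∀ j, j ≠ i → x j * Q j = Q j * x j)
    (hxy : ∀ j, j ≠ i → x j * y j = 1)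
    (hyx : ∀ j, j ≠ i → y j * x j = 1)
    (hWP : ∀ j, j ≠ i → W * P j = (P j - d * Q j) * W)
    (hWi : W * P i = P i * W)
    (hWe : W * e = (e - d * P i) * W)
    (hGj : ∀ j, j ≠ i → x j * (G j * W) = (x j - d) * (W * G j))
    (hGi : G i * W = W * G i + d * W + d * ∑ j ∈ univ.erase i, y j * (W * G j)) :
    (∑ j, P j * G j - e) * W = W * (∑ j, P j * G j - e) := by
  rw [← Finset.add_sum_erase _ _ (mem_univ i)]
  have key : (∑ j ∈ univ.erase i, P j * G j) * W
      + P i * (d * ∑ j ∈ univ.erase i, y j * (W * G j))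
      = W * ∑ j ∈ univ.erase i, P j * G j := by
    simp only [Finset.mul_sum, Finset.sum_mul]
    rw [← Finset.sum_add_distrib]
    apply Finset.sum_congr rfl
    intro j hj
    have hj' : j ≠ i := Finset.ne_of_mem_erase hj
    have h1 : G j * W = (1 - y j * d) * (W * G j) := by
      calc G j * W = (y j * x j) * (G j * W) := by rw [hyx j hj', one_mul]
        _ = y j * (x j * (G j * W)) := by rw [mul_assoc]
        _ = (y j * x j - y j * d) * (W * G j) := by rw [hGj j hj']; noncomm_ring
        _ = _ := by rw [hyx j hj']
    have h2 : P j = P i + Q j * x j := by rw [← hxQ j hj', ← hPQ j hj']; abel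
    have h3 : P j * (1 - y j * d) + P i * (d * y j) = P j - d * Q j := by
      calc P j * (1 - y j * d) + P i * (d * y j)
          = P j - P j * y j * d + P i * y j * d := by rw [hd (y j)]; noncomm_ring
        _ = P j - (P i + Q j * x j) * y j * d + P i * y j * d := by rw [← h2]
        _ = P j - Q j * (x j * y j) * d := by noncomm_ring
        _ = _ := by rw [hxy j hj', hd]; simp
    calc P j * G j * W + P i * (d * (y j * (W * G j)))
        = P j * (G j * W) + P i * (d * y j) * (W * G j) := by noncomm_ring
      _ = (P j * (1 - y j * d) + P i * (d * y j)) * (W * G j) := by rw [h1]; noncomm_ring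
      _ = ((P j - d * Q j) * W) * G j := by rw [h3, mul_assoc]
      _ = _ := by rw [← hWP j hj', mul_assoc]
  calc (P i * G i + ∑ j ∈ univ.erase i, P j * G j - e) * W
      = P i * (G i * W) + (∑ j ∈ univ.erase i, P j * G j) * W - e * W := by noncomm_ring
    _ = P i * W * G i + P i * d * W + ((∑ j ∈ univ.erase i, P j * G j) * W
      + P i * (d * ∑ j ∈ univ.erase i, y j * (W * G j))) - e * W := by
        rw [hGi]; simp only [mul_add, mul_assoc]; abel
    _ = W * P i * G i + W * (∑ j ∈ univ.erase i, P j * G j) - (e - d * P i) * W := by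
        rw [key, hWi, hd]; noncomm_ring
    _ = _ := by rw [← hWe]; noncomm_ring

theorem cancel_aux {A : Type*} [Ring A] {a b c : A} (ha : IsUnit a) (h : a * b = a * c) : b = c :=
  ha.mul_left_cancel h

theorem stmt5 {k A : Type*} [Field k] [CharZero k] [Ring A] [Algebra k A]
    {n : ℕ} (hn : 1 ≤ n) (h Z D : Fin n → A)
    (hcomm : ∀ i j, h i * h j = h j * h i)
    (hunit : ∀ (i j : Fin n) (m : ℤ), i ≠ j → IsUnit (h i - h j + (m : A)))
    (hhZ : ∀ i j, h i * Z j = Z j * (h i + if i = j then 1 else 0))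
    (hhD : ∀ i j, h i * D j = D j * (h i - if i = j then 1 else 0))
    (hZZ : ∀ i j, i < j →
      Z i * Z j = (h i - h j + 1) * Ring.inverse (h i - h j) * (Z j * Z i))
    (hDD : ∀ i j, i < j →
      D i * D j = (h i - h j - 1) * Ring.inverse (h i - h j) * (D j * D i))
    (hZD : ∀ i j, i < j → Z i * D j = D j * Z i)
    (hZD' : ∀ i j, j < i → Z i * D j =
      (h i - h j) * (h i - h j - 2) * (Ring.inverse (h i - h j - 1)) ^ 2 * (D j * Z i))
    (hZDdiag : ∀ i, Z i * D i =
      (∑ j, Ring.inverse (1 - (h i - h j)) * (D j * Z j)) - 1) :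
    ∀ (K : ℕ), 1 ≤ K → K ≤ n → ∀ c : A,
      c = (∑ j, (∑ s ∈ (Finset.univ.erase j).powersetCard (K - 1), oprod s h) * (D j * Z j)) -
          ∑ s ∈ Finset.univ.powersetCard K, oprod s h →
      ∀ j, c * h j = h j * c ∧ c * Z j = Z j * c ∧ c * D j = D j * c := by
  -- basic units
  have u0 : ∀ i j, i ≠ j → IsUnit (h i - h j) := fun i j hij => by
    simpa using hunit i j 0 hij
  have um1 : ∀ i j, i ≠ j → IsUnit (h i - h j - 1) := fun i j hij => by
    simpa [sub_eq_add_neg] using hunit i j (-1) hij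
  -- commutations with h
  have hZn : ∀ i j, i ≠ j → h i * Z j = Z j * h i := fun i j hij => by
    rw [hhZ, if_neg hij, add_zero]
  have hDn : ∀ i j, i ≠ j → h i * D j = D j * h i := fun i j hij => by
    rw [hhD, if_neg hij, sub_zero]
  have hZs : ∀ i, Z i * h i = (h i - 1) * Z i := fun i => by
    rw [sub_mul, hhZ, if_pos rfl]; noncomm_ring
  have hDs : ∀ i, D i * h i = (h i + 1) * D i := fun i => by
    rw [add_mul, hhD, if_pos rfl]; noncomm_ring
  have hG : ∀ i j, h i * (D j * Z j) = D j * Z j * h i := fun i j => by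
    rcases eq_or_ne i j with rfl | hij
    · rw [mul_assoc, hZs, ← mul_assoc (D i), mul_sub, hDs]; noncomm_ring
    · rw [← mul_assoc, hDn _ _ hij, mul_assoc, hZn _ _ hij, mul_assoc]
  have hxD : ∀ i j, i ≠ j → D j * (h i - h j) = (h i - h j - 1) * D j := fun i j hij => by
    rw [mul_sub, hDs, ← hDn _ _ hij]; noncomm_ring
  -- inverse free relations
  have hxx : ∀ i j, Commute (h i) (h j) := hcomm
  have rZZ : ∀ i j, i < j → (h i - h j) * (Z i * Z j) = (h i - h j + 1) * (Z j * Z i) := by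
    intro i j hij
    rw [hZZ i j hij, ← mul_assoc]
    congr 1
    have : (h i - h j) * (h i - h j + 1) = (h i - h j + 1) * (h i - h j) := by noncomm_ring
    rw [← mul_assoc, this, mul_assoc, Ring.mul_inverse_cancel _ (u0 i j hij.ne), mul_one]
  have rDD : ∀ i j, i < j → (h i - h j) * (D i * D j) = (h i - h j - 1) * (D j * D i) := by
    intro i j hij
    rw [hDD i j hij, ← mul_assoc]
    congr 1
    have : (h i - h j) * (h i - h j - 1) = (h i - h j - 1) * (h i - h j) := by noncomm_ring
    rw [← mul_assoc, this, mul_assoc, Ring.mul_inverse_cancel _ (u0 i j hij.ne), mul_one]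
  have rZD : ∀ i j, j < i → (h i - h j - 1) * (h i - h j - 1) * (Z i * D j) =
      (h i - h j) * (h i - h j - 2) * (D j * Z i) := by
    intro i j hij
    rw [hZD' i j hij, ← mul_assoc]
    congr 1
    generalize hx : h i - h j = x
    have ux : IsUnit (x - 1) := hx ▸ um1 i j hij.ne'
    have : (x - 1) * (x - 1) * (x * (x - 2)) = (x * (x - 2)) * ((x - 1) * (x - 1)) := by
      noncomm_ring
    rw [← mul_assoc, this, pow_two, mul_assoc, mul_assoc (x - 1), ← mul_assoc (x - 1) (Ring.inverse _),
      Ring.mul_inverse_cancel _ ux, one_mul, Ring.mul_inverse_cancel _ ux, mul_one]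
  have clA : ∀ i j, j ≠ i → (h i - h j) * (D j * Z j * Z i)
      = (h i - h j - 1) * (Z i * (D j * Z j)) := by
    intro i j hji
    have e0 := hxD i j hji.symm
    have ux := um1 i j hji.symm
    rcases lt_or_gt_of_ne hji with hlt | hlt
    · have e1 := rZZ j i hlt
      have e2 := rZD i j hlt
      have e1' : (h i - h j) * (Z j * Z i) = (h i - h j - 1) * (Z i * Z j) := by
        have : h j - h i = - (h i - h j) := by abel
        rw [this] at e1
        generalize h i - h j = x at *
        have := congrArg Neg.neg e1
        simp only [neg_mul, neg_neg] at this
        rw [this]; noncomm_ring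
      clear e1
      generalize h i - h j = x at *
      apply cancel_aux ux
      have e3 : (x - 1) * (D j * (Z j * Z i)) = (x - 2) * (D j * (Z i * Z j)) := by
        calc (x - 1) * (D j * (Z j * Z i)) = (D j * x) * (Z j * Z i) := by rw [e0]; noncomm_ring
          _ = D j * (x * (Z j * Z i)) := by noncomm_ring
          _ = (D j * x) * (Z i * Z j) - D j * (Z i * Z j) := by rw [e1']; noncomm_ring
          _ = _ := by rw [e0]; noncomm_ring
      calc (x - 1) * (x * (D j * Z j * Z i)) = x * ((x - 1) * (D j * (Z j * Z i))) := by
            noncomm_ring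
        _ = (x * (x - 2) * (D j * Z i)) * Z j := by rw [e3]; noncomm_ring
        _ = _ := by rw [← e2]; noncomm_ring
    · have e1 := rZZ i j hlt
      have e2 := hZD i j hlt
      generalize h i - h j = x at *
      calc x * (D j * Z j * Z i) = (D j * x) * (Z j * Z i) + D j * (Z j * Z i) := by
            rw [e0]; noncomm_ring
        _ = D j * ((x + 1) * (Z j * Z i)) := by noncomm_ring
        _ = (D j * x) * (Z i * Z j) := by rw [← e1]; noncomm_ring
        _ = (x - 1) * (D j * Z i * Z j) := by rw [e0]; noncomm_ring
        _ = _ := by rw [← e2]; noncomm_ring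
  have clB : ∀ i j, j ≠ i → (h i - h j) * (D j * Z j * D i)
      = (h i - h j + 1) * (D i * (D j * Z j)) := by
    intro i j hji
    have e0 := hxD i j hji.symm
    have ux := u0 i j hji.symm
    rcases lt_or_gt_of_ne hji with hlt | hlt
    · have e1 := rDD j i hlt
      have e2 := hZD j i hlt
      have : h j - h i = - (h i - h j) := by abel
      rw [this] at e1
      generalize h i - h j = x at *
      calc x * (D j * Z j * D i) = - ((-x) * (D j * D i)) * Z j := by
            rw [mul_assoc (D j), e2]; noncomm_ring
        _ = _ := by rw [e1]; noncomm_ring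
    · have e1 := rDD i j hlt
      have e2 := rZD j i hlt
      have : h j - h i = - (h i - h j) := by abel
      rw [this] at e2
      generalize h i - h j = x at *
      apply cancel_aux ux
      have e3 : (x + 1) * (x + 1) * (Z j * D i) = x * (x + 2) * (D i * Z j) := by
        calc (x + 1) * (x + 1) * (Z j * D i) = (-x - 1) * (-x - 1) * (Z j * D i) := by
              noncomm_ring
          _ = _ := by rw [e2]; noncomm_ring
      have e4 : D j * ((x + 1) * (x + 1)) = x * x * D j := by
        calc D j * ((x + 1) * (x + 1)) = (D j * x) * x + 2 * (D j * x) + D j := by noncomm_ring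
          _ = ((x - 1) * D j) * x + 2 * ((x - 1) * D j) + D j := by rw [e0]
          _ = (x - 1) * (D j * x) + 2 * ((x - 1) * D j) + D j := by rw [mul_assoc]
          _ = _ := by rw [e0]; noncomm_ring
      have e5 : D j * (x * (x + 2)) = (x + 1) * (x - 1) * D j := by
        calc D j * (x * (x + 2)) = (D j * x) * x + 2 * (D j * x) := by noncomm_ring
          _ = ((x - 1) * D j) * x + 2 * ((x - 1) * D j) := by rw [e0]
          _ = (x - 1) * (D j * x) + 2 * ((x - 1) * D j) := by rw [mul_assoc]
          _ = _ := by rw [e0]; noncomm_ring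
      calc x * (x * (D j * Z j * D i)) = (x * x * D j) * (Z j * D i) := by noncomm_ring
        _ = D j * ((x + 1) * (x + 1) * (Z j * D i)) := by rw [← e4]; noncomm_ring
        _ = (D j * (x * (x + 2))) * (D i * Z j) := by rw [e3]; noncomm_ring
        _ = (x + 1) * ((x - 1) * (D j * D i)) * Z j := by rw [e5]; noncomm_ring
        _ = _ := by rw [← e1]; noncomm_ring
  -- diagonal relations
  have inv_one : Ring.inverse (1 : A) = 1 := Ring.inverse_one A
  have diag : ∀ i, Z i * D i = D i * Z i
      + (∑ j ∈ univ.erase i, Ring.inverse (1 - (h i - h j)) * (D j * Z j)) - 1 := by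
    intro i
    rw [hZDdiag i, ← Finset.add_sum_erase _ _ (mem_univ i)]
    simp
  have dgZ : ∀ i, D i * Z i * Z i = Z i * (D i * Z i) + 1 * Z i
      + 1 * ∑ j ∈ univ.erase i, Ring.inverse (h i - h j) * (Z i * (D j * Z j)) := by
    intro i
    have e : (∑ j ∈ univ.erase i, Ring.inverse (1 - (h i - h j)) * (D j * Z j)) * Z i
        = - ∑ j ∈ univ.erase i, Ring.inverse (h i - h j) * (Z i * (D j * Z j)) := by
      rw [Finset.sum_mul, ← Finset.sum_neg_distrib]
      apply Finset.sum_congr rfl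
      intro j hj
      have hji : j ≠ i := Finset.ne_of_mem_erase hj
      have c1 := clA i j hji
      have ux := u0 i j hji.symm
      have uy := um1 i j hji.symm
      generalize h i - h j = x at *
      have uy' : IsUnit (1 - x) := by simpa using uy.neg
      apply cancel_aux uy'
      apply cancel_aux ux
      calc x * ((1 - x) * (Ring.inverse (1 - x) * (D j * Z j) * Z i))
          = x * (((1 - x) * Ring.inverse (1 - x)) * (D j * Z j * Z i)) := by noncomm_ring
        _ = (x - 1) * (Z i * (D j * Z j)) := by
            rw [Ring.mul_inverse_cancel _ uy', one_mul, c1]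
        _ = (x - 1) * ((x * Ring.inverse x) * (Z i * (D j * Z j))) := by
            rw [Ring.mul_inverse_cancel _ ux, one_mul]
        _ = _ := by noncomm_ring
    have e' := congrArg (· * Z i) (diag i)
    simp only [add_mul, sub_mul, e] at e'
    rw [← mul_assoc (Z i), e']
    noncomm_ring
  have dgD : ∀ i, D i * Z i * D i = D i * (D i * Z i) + (-1) * D i
      + (-1) * ∑ j ∈ univ.erase i, Ring.inverse (h i - h j) * (D i * (D j * Z j)) := by
    intro i
    have e : D i * (∑ j ∈ univ.erase i, Ring.inverse (1 - (h i - h j)) * (D j * Z j))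
        = - ∑ j ∈ univ.erase i, Ring.inverse (h i - h j) * (D i * (D j * Z j)) := by
      rw [Finset.mul_sum, ← Finset.sum_neg_distrib]
      apply Finset.sum_congr rfl
      intro j hj
      have hji : j ≠ i := Finset.ne_of_mem_erase hj
      have ux := u0 i j hji.symm
      have uy := um1 i j hji.symm
      have e1 : D i * (h i - h j) = (h i - h j + 1) * D i := by
        rw [mul_sub, hDs, ← hDn _ _ hji]; noncomm_ring
      generalize h i - h j = x at *
      have uy' : IsUnit (1 - x) := by simpa using uy.neg
      apply cancel_aux ux
      calc x * (D i * (Ring.inverse (1 - x) * (D j * Z j)))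
          = (D i - ((x + 1) * D i) + 2 * (x * D i)) * (Ring.inverse (1 - x) * (D j * Z j)) := by
            noncomm_ring
        _ = _ := ?_
      have e2 : x * D i = - (D i * (1 - x)) := by rw [mul_sub, e1]; noncomm_ring
      calc (D i - ((x + 1) * D i) + 2 * (x * D i)) * (Ring.inverse (1 - x) * (D j * Z j))
          = (x * D i) * (Ring.inverse (1 - x) * (D j * Z j)) := by noncomm_ring
        _ = - (D i * (((1 - x) * Ring.inverse (1 - x)) * (D j * Z j))) := by
            rw [e2]; noncomm_ring
        _ = - ((x * Ring.inverse x) * (D i * (D j * Z j))) := by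
            rw [Ring.mul_inverse_cancel _ uy', Ring.mul_inverse_cancel _ ux, one_mul, one_mul]
        _ = _ := by noncomm_ring
    rw [mul_assoc, diag i, mul_sub, mul_add, e]
    noncomm_ring
  -- main
  intro K hK _ c hc i
  obtain ⟨m, rfl⟩ : ∃ m, K = m + 1 := ⟨K - 1, by omega⟩
  have hc' : c = ∑ j, EE h (univ.erase j) m * (D j * Z j) - EE h univ (m + 1) := hc
  have hins : ∀ j, j ≠ i → univ.erase j = insert i ((univ.erase i).erase j) := by
    intro j hj
    ext l; simp only [mem_erase, mem_insert, mem_univ, and_true]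
    by_cases hl : l = i
    · simp [hl, hj.symm]
    · simp [hl]
  have hins2 : ∀ j, j ≠ i → univ.erase i = insert j ((univ.erase i).erase j) := by
    intro j hj
    exact (Finset.insert_erase (by simp [hj])).symm
  have Pj : ∀ j, j ≠ i → EE h (univ.erase j) m = EE h ((univ.erase i).erase j) m
      + h i * FF h ((univ.erase i).erase j) m := by
    intro j hj
    conv_lhs => rw [hins j hj]
    exact EE_insert h hcomm _ _ (by simp) _
  have Pi : ∀ j, j ≠ i → EE h (univ.erase i) m = EE h ((univ.erase i).erase j) m
      + h j * FF h ((univ.erase i).erase j) m := by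
    intro j hj
    conv_lhs => rw [hins2 j hj]
    exact EE_insert h hcomm _ _ (by simp) _
  have Pe : EE h univ (m + 1) = EE h (univ.erase i) (m + 1) + h i * EE h (univ.erase i) m := by
    conv_lhs => rw [← Finset.insert_erase (mem_univ i)]
    rw [EE_insert h hcomm _ _ (by simp)]
    simp [FF]
  have fin : ∀ (W d : A), (∀ a, d * a = a * d) → (∀ l, l ≠ i → W * h l = h l * W) →
      W * h i = (h i - d) * W →
      (∀ j, j ≠ i → (h i - h j) * (D j * Z j * W) = (h i - h j - d) * (W * (D j * Z j))) →
      (D i * Z i * W = W * (D i * Z i) + d * W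
        + d * ∑ j ∈ univ.erase i, Ring.inverse (h i - h j) * (W * (D j * Z j))) →
      c * W = W * c := by
    intro W d hd w1 w2 w3 w4
    rw [hc']
    have cE : ∀ m, W * EE h (univ.erase i) m = EE h (univ.erase i) m * W := fun m =>
      EE_commute h _ m W fun l hl => w1 l (Finset.ne_of_mem_erase hl)
    have mem2 : ∀ j l, l ∈ (univ.erase i).erase j → l ≠ i := fun j l hl =>
      Finset.ne_of_mem_erase (Finset.mem_of_mem_erase hl)
    have cE2 : ∀ j, W * EE h ((univ.erase i).erase j) m = EE h ((univ.erase i).erase j) m * W :=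
      fun j => EE_commute h _ m W fun l hl => w1 l (mem2 j l hl)
    have cF2 : ∀ j, W * FF h ((univ.erase i).erase j) m = FF h ((univ.erase i).erase j) m * W :=
      fun j => FF_commute h _ m W fun l hl => w1 l (mem2 j l hl)
    refine central_aux i W (EE h univ (m + 1)) d (fun j => D j * Z j)
      (fun j => EE h (univ.erase j) m) (fun j => FF h ((univ.erase i).erase j) m)
      (fun j => h i - h j) (fun j => Ring.inverse (h i - h j)) hd ?_ ?_ ?_ ?_ ?_ ?_ ?_ w3 w4
    · intro j hj
      show EE h (univ.erase j) m - EE h (univ.erase i) m = _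
      rw [Pj j hj, Pi j hj]; noncomm_ring
    · intro j hj
      exact FF_commute h _ m _ fun l hl => (hxx i l).sub_left (hxx j l)
    · intro j hj
      exact Ring.mul_inverse_cancel _ (u0 i j hj.symm)
    · intro j hj
      exact Ring.inverse_mul_cancel _ (u0 i j hj.symm)
    · intro j hj
      show W * EE h (univ.erase j) m = (EE h (univ.erase j) m - _) * W
      rw [Pj j hj, mul_add, cE2, ← mul_assoc, w2, mul_assoc, cF2]; noncomm_ring
    · exact cE m
    · show W * EE h univ (m + 1) = (EE h univ (m + 1) - d * EE h (univ.erase i) m) * W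
      rw [Pe, mul_add, cE, ← mul_assoc, w2, mul_assoc, cE]; noncomm_ring
  refine ⟨?_, ?_, ?_⟩
  · rw [hc']
    symm
    change Commute _ _
    apply Commute.sub_right
    · apply Commute.sum_right
      intro j _
      exact (EE_commute h _ m _ fun l _ => hxx i l).mul_right (hG i j)
    · exact EE_commute h _ _ _ fun l _ => hxx i l
  · exact fin (Z i) 1 (by simp) (fun l hl => (hZn l i hl).symm) (hZs i) (clA i) (dgZ i)
  · refine fin (D i) (-1) (by simp) (fun l hl => (hDn l i hl).symm) ?_ ?_ (dgD i)
    · rw [hDs, sub_neg_eq_add]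
    · intro j hj
      rw [clB i j hj, sub_neg_eq_add]
end

section
/- Set φ_i = Π_{k: k>i} h̃_{ik}(h̃_{ik} − 1)^{−1}, and in the opposite algebra A^op consider the elements h̃'_i = h̃_i, Z'^i = ∂_i φ_i^{−1}, ∂'_i = φ_i Z^i. Then these elements satisfy in A^op the same defining relations of Diff_h(n): h̃'_i Z'^j = Z'^j (h̃'_i + δ_{ij}) and h̃'_i ∂'_j = ∂'_j (h̃'_i − δ_{ij}) for all i, j; Z'^i Z'^j = (h̃_{ij} + 1) h̃_{ij}^{−1} Z'^j Z'^i for i < j; ∂'_i ∂'_j = (h̃_{ij} − 1) h̃_{ij}^{−1} ∂'_j ∂'_i for i < j; Z'^i ∂'_j = ∂'_j Z'^i for i < j; Z'^i ∂'_j = h̃_{ij}(h̃_{ij} − 2)(h̃_{ij} − 1)^{−2} ∂'_j Z'^i for i > j; and Z'^i ∂'_i = Σ_{j=1}^n (1 − h̃_{ij})^{−1} ∂'_j Z'^j − 1 for each i (all products and coefficient placements taken in A^op). This expresses that ε: h̃_i ↦ h̃_i, ∂_i ↦ φ_i Z^i, Z^i ↦ ∂_i φ_i^{−1} is an anti-homomorphism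 of Diff_h(n). -/
open Finset

universe u in
theorem exists_comm_model {A : Type u} [Ring A] {n : ℕ} (h : Fin n → A)
    (hcomm : ∀ i j, h i * h j = h j * h i) :
    ∃ (C : Type u) (_ : CommRing C) (ι : C →+* A) (x : Fin n → C),
      (∀ i, ι (x i) = h i) ∧ (∀ c, IsUnit (ι c) → IsUnit c) ∧
      (∀ a, (∀ i, Commute a (h i)) → ∀ c, Commute a (ι c)) := by
  let S : Subring A := Subring.centralizer (Subring.centralizer (Set.range h) : Set A)
  have hS : ∀ a, (∀ i, Commute a (h i)) → ∀ c : S, Commute a (c : A) := by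
    intro a ha c
    have hc := c.2
    rw [Subring.mem_centralizer_iff] at hc
    apply hc
    change a ∈ Subring.centralizer (Set.range h)
    rw [Subring.mem_centralizer_iff]
    rintro _ ⟨i, rfl⟩
    exact (ha i).symm
  have hS2 : ∀ y, (∀ a, (∀ i, Commute a (h i)) → Commute a y) → y ∈ S := by
    intro y hy
    rw [Subring.mem_centralizer_iff]
    intro a ha
    have ha : a ∈ Subring.centralizer (Set.range h) := ha
    rw [Subring.mem_centralizer_iff] at ha
    exact hy a (fun i => (ha _ ⟨i, rfl⟩).symm)
  have hcc : ∀ c d : S, c * d = d * c := by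
    intro c d
    apply Subtype.ext
    exact hS c (fun i => (hS (h i) (fun j => hcomm i j) c).symm) d
  refine ⟨S, { (inferInstance : Ring S) with mul_comm := hcc }, S.subtype,
    fun i => ⟨h i, hS2 _ (fun a ha => ha i)⟩, fun i => rfl, ?_, hS⟩
  intro c hc
  obtain ⟨u, hu⟩ := hc
  have hu : (u : A) = c := hu
  have hm : ((u⁻¹ : Aˣ) : A) ∈ S := by
    apply hS2
    intro a ha
    have := hS a ha c
    rw [← hu] at this
    exact this.units_inv_right
  refine ⟨⟨c, ⟨_, hm⟩, ?_, ?_⟩, rfl⟩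
  · apply Subtype.ext
    change (c : A) * _ = 1
    rw [← hu]; simp
  · apply Subtype.ext
    change _ * (c : A) = 1
    rw [← hu]; simp

theorem map_ringInverse {C A : Type*} [Ring C] [Ring A] (ι : C →+* A) {c : C} (hc : IsUnit c) :
    ι (Ring.inverse c) = Ring.inverse (ι c) := by
  obtain ⟨u, rfl⟩ := hc
  rw [Ring.inverse_unit]
  have : ι (u : C) = ((Units.map (ι : C →* A) u : Aˣ) : A) := rfl
  rw [this, Ring.inverse_unit, ← map_inv]
  rfl

theorem op_ringInverse {A : Type*} [Ring A] {a : A} (ha : IsUnit a) :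
    Ring.inverse (MulOpposite.op a) = MulOpposite.op (Ring.inverse a) := by
  have hu : IsUnit (MulOpposite.op a) := ha.op
  have : MulOpposite.op a * MulOpposite.op (Ring.inverse a) = 1 := by
    rw [← MulOpposite.op_mul, Ring.inverse_mul_cancel _ ha, MulOpposite.op_one]
  calc _ = Ring.inverse (MulOpposite.op a) * (MulOpposite.op a * MulOpposite.op (Ring.inverse a)) := by
        rw [this, mul_one]
    _ = _ := by rw [← mul_assoc, Ring.inverse_mul_cancel _ hu, one_mul]

theorem semi_inv {C A : Type*} [Ring C] [Ring A] (ι : C →+* A) {c d : C} {a : A}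
    (hc : IsUnit c) (hd : IsUnit d) (hs : SemiconjBy a (ι c) (ι d)) :
    SemiconjBy a (ι (Ring.inverse c)) (ι (Ring.inverse d)) := by
  unfold SemiconjBy at *
  calc a * ι (Ring.inverse c)
      = ι (Ring.inverse d * d) * a * ι (Ring.inverse c) := by
        rw [Ring.inverse_mul_cancel _ hd]; simp
    _ = ι (Ring.inverse d) * (a * ι c) * ι (Ring.inverse c) := by
        rw [hs, map_mul]; simp only [mul_assoc]
    _ = ι (Ring.inverse d) * a * ι (c * Ring.inverse c) := by
        rw [map_mul]; simp only [mul_assoc]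
    _ = _ := by rw [Ring.mul_inverse_cancel _ hc]; simp

theorem oprod_map {C A : Type*} [CommRing C] [Ring A] (ι : C →+* A) {n : ℕ}
    (s : Finset (Fin n)) (f : Fin n → C) :
    oprod s (fun m => ι (f m)) = ι (∏ m ∈ s, f m) := by
  unfold oprod
  have h1 : (s.sort (· ≤ ·)).map (fun m => ι (f m)) = ((s.sort (· ≤ ·)).map f).map ι := by simp
  rw [h1, ← map_list_prod]
  congr 1
  have h2 : ((s.sort (· ≤ ·) : List (Fin n)) : Multiset (Fin n)) = s.val := Finset.sort_eq s _
  rw [Finset.prod, ← h2, Multiset.map_coe, Multiset.prod_coe]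

section core

variable {C A : Type*} [CommRing C] [Ring A] {n : ℕ}

/-- shifted difference -/
def pp (x : Fin n → C) (i j : Fin n) (m : ℤ) : C := x i - x j + (m : C)

/-- inverse of shifted difference -/
noncomputable def qq (x : Fin n → C) (i j : Fin n) (m : ℤ) : C := Ring.inverse (pp x i j m)

/-- the element phi -/
noncomputable def ff (x : Fin n → C) (i : Fin n) : C :=
  ∏ m ∈ Finset.univ.filter (fun m => i < m), pp x i m 0 * qq x i m (-1)

variable (ι : C →+* A) (x : Fin n → C)
  (hu : ∀ (i j : Fin n) (m : ℤ), i ≠ j → IsUnit (pp x i j m))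

/-- `a` shifts `x j` by `-e`. -/
def Shifts (ι : C →+* A) (x : Fin n → C) (a : A) (j : Fin n) (e : ℤ) : Prop :=
  ∀ i, SemiconjBy a (ι (x i)) (ι (x i - if i = j then (e : C) else 0))

theorem shifts_pp {a : A} {j : Fin n} {e : ℤ} (hs : Shifts ι x a j e) (i l : Fin n) (m : ℤ) :
    SemiconjBy a (ι (pp x i l m))
      (ι (pp x i l (m - (if i = j then e else 0) + (if l = j then e else 0)))) := by
  have h1 : SemiconjBy a (ι (m : C)) (ι (m : C)) := by
    rw [map_intCast]; exact (Int.cast_commute m a).symm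
  have := ((hs i).sub_right (hs l)).add_right h1
  simp only [← map_sub, ← map_add] at this
  unfold pp
  convert this using 2
  push_cast
  ring

include hu

theorem shifts_qq {a : A} {j : Fin n} {e : ℤ} (hs : Shifts ι x a j e) (i l : Fin n) (m : ℤ)
    (hil : i ≠ l) :
    SemiconjBy a (ι (qq x i l m))
      (ι (qq x i l (m - (if i = j then e else 0) + (if l = j then e else 0)))) :=
  semi_inv ι (hu _ _ _ hil) (hu _ _ _ hil) (shifts_pp ι x hs i l m)

theorem shifts_prod {a : A} {j : Fin n} {e : ℤ} (hs : Shifts ι x a j e) (i : Fin n) (hij : i ≠ j)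
    (s : Finset (Fin n)) (his : i ∉ s) (hjs : j ∉ s) :
    SemiconjBy a (ι (∏ m ∈ s, pp x i m 0 * qq x i m (-1)))
      (ι (∏ m ∈ s, pp x i m 0 * qq x i m (-1))) := by
  apply Finset.prod_induction _ (fun c => SemiconjBy a (ι c) (ι c))
  · intro c d hc hd
    rw [map_mul]; exact hc.mul_right hd
  · simp
  · intro m hm
    have hmj : m ≠ j := fun h => hjs (h ▸ hm)
    have hmi : i ≠ m := fun h => his (h ▸ hm)
    have h1 := shifts_pp ι x hs i m 0
    have h2 := shifts_qq ι x hu hs i m (-1) hmi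
    simp only [hij, hmj, if_false, sub_zero, add_zero] at h1 h2
    rw [map_mul]; exact h1.mul_right h2

theorem unit_prod (i : Fin n) (s : Finset (Fin n)) (his : i ∉ s) :
    IsUnit (∏ m ∈ s, pp x i m 0 * qq x i m (-1)) := by
  apply Finset.prod_induction _ IsUnit
  · intro c d hc hd; exact hc.mul hd
  · exact isUnit_one
  · intro m hm
    have hmi : i ≠ m := fun h => his (h ▸ hm)
    exact (hu _ _ _ hmi).mul (hu _ _ _ hmi).ringInverse

theorem unit_ff (i : Fin n) : IsUnit (ff x i) := unit_prod x hu i _ (by simp)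

theorem ff_comm {a : A} {j : Fin n} {e : ℤ} (hs : Shifts ι x a j e) (i : Fin n) (hji : j < i) :
    SemiconjBy a (ι (ff x i)) (ι (ff x i)) :=
  shifts_prod ι x hu hs i hji.ne' _ (by simp) (by simp [hji.le])

theorem gg_comm {a : A} {j : Fin n} {e : ℤ} (hs : Shifts ι x a j e) (i : Fin n) (hji : j < i) :
    SemiconjBy a (ι (Ring.inverse (ff x i))) (ι (Ring.inverse (ff x i))) :=
  semi_inv ι (unit_ff x hu i) (unit_ff x hu i) (ff_comm ι x hu hs i hji)

theorem pq (i j : Fin n) (m : ℤ) (hij : i ≠ j) : (x i - x j + m) * qq x i j m = 1 :=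
  Ring.mul_inverse_cancel _ (hu i j m hij)

/-- Shifted phi. -/
theorem ff_shift {a : A} {j : Fin n} {e : ℤ} (hs : Shifts ι x a j e) (i : Fin n) (hij : i < j) :
    SemiconjBy a (ι (ff x i))
      (ι (ff x i * (pp x i j e * qq x i j (e - 1) * pp x i j (-1) * qq x i j 0))) := by
  have hmem : j ∈ Finset.univ.filter (fun m => i < m) := by simpa using hij
  have hf : ff x i = _ := (Finset.mul_prod_erase _ (fun m => pp x i m 0 * qq x i m (-1)) hmem).symm
  have hr := shifts_prod ι x hu hs i hij.ne ((Finset.univ.filter (fun m => i < m)).erase j)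
    (by simp) (by simp)
  generalize (∏ m ∈ (Finset.univ.filter (fun m => i < m)).erase j,
    pp x i m 0 * qq x i m (-1)) = ρ at hf hr
  have h1 := shifts_pp ι x hs i j 0
  have h2 := shifts_qq ι x hu hs i j (-1) hij.ne
  have key := (h1.mul_right h2).mul_right hr
  simp only [← map_mul, hij.ne, if_false, if_true] at key
  rw [hf]
  suffices E : pp x i j 0 * qq x i j (-1) * ρ *
      (pp x i j e * qq x i j (e - 1) * pp x i j (-1) * qq x i j 0) =
      pp x i j (0 - 0 + e) * qq x i j (-1 - 0 + e) * ρ by rw [E]; exact key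
  have e1 := pq x hu i j 0 hij.ne
  have e2 := pq x hu i j (-1) hij.ne
  have e3 : (0 : ℤ) - 0 + e = e := by ring
  have e4 : (-1 : ℤ) - 0 + e = e - 1 := by ring
  rw [e3, e4]
  unfold pp
  push_cast at *
  linear_combination ((x i - x j + e) * qq x i j (e - 1) * ρ * (x i - x j + -1) * qq x i j (-1)) * e1
    + ((x i - x j + e) * qq x i j (e - 1) * ρ) * e2

/-- ratio cancellation -/
theorem gg_shift {a : A} {j : Fin n} {e : ℤ} (hs : Shifts ι x a j e) (i : Fin n) (hij : i < j) :
    SemiconjBy a (ι (Ring.inverse (ff x i)))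
      (ι (Ring.inverse (ff x i) * (qq x i j e * pp x i j (e - 1) * qq x i j (-1) * pp x i j 0))) := by
  have U := fun m => hu i j m hij.ne
  have V := fun m => (hu i j m hij.ne).ringInverse
  have hd : IsUnit (ff x i * (pp x i j e * qq x i j (e - 1) * pp x i j (-1) * qq x i j 0)) :=
    (unit_ff x hu i).mul ((((U _).mul (V _)).mul (U _)).mul (V _))
  have := semi_inv ι (unit_ff x hu i) hd (ff_shift ι x hu hs i hij)
  convert this using 2
  apply hd.mul_left_cancel
  rw [Ring.mul_inverse_cancel _ hd]
  have e0 := Ring.mul_inverse_cancel _ (unit_ff x hu i)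
  have e1 : pp x i j e * qq x i j e = 1 := pq x hu i j e hij.ne
  have e2 : pp x i j (e-1) * qq x i j (e-1) = 1 := pq x hu i j (e-1) hij.ne
  have e3 : pp x i j (-1) * qq x i j (-1) = 1 := pq x hu i j (-1) hij.ne
  have e4 : pp x i j 0 * qq x i j 0 = 1 := pq x hu i j 0 hij.ne
  calc _ = (ff x i * Ring.inverse (ff x i)) * (pp x i j e * qq x i j e) *
        (pp x i j (e-1) * qq x i j (e-1)) * (pp x i j (-1) * qq x i j (-1)) *
        (pp x i j 0 * qq x i j 0) := by ring
    _ = 1 := by rw [e0, e1, e2, e3, e4]; ring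

theorem ff_back {a : A} {j : Fin n} {e : ℤ} (hs : Shifts ι x a j e) (i : Fin n) (hij : i < j) :
    SemiconjBy a
      (ι (ff x i * (pp x i j (-e) * qq x i j (-1 - e) * pp x i j (-1) * qq x i j 0)))
      (ι (ff x i)) := by
  have hmem : j ∈ Finset.univ.filter (fun m => i < m) := by simpa using hij
  have hf : ff x i = _ := (Finset.mul_prod_erase _ (fun m => pp x i m 0 * qq x i m (-1)) hmem).symm
  have hr := shifts_prod ι x hu hs i hij.ne ((Finset.univ.filter (fun m => i < m)).erase j)
    (by simp) (by simp)
  generalize (∏ m ∈ (Finset.univ.filter (fun m => i < m)).erase j,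
    pp x i m 0 * qq x i m (-1)) = ρ at hf hr
  have h1 := shifts_pp ι x hs i j (-e)
  have h2 := shifts_qq ι x hu hs i j (-1 - e) hij.ne
  have key := (h1.mul_right h2).mul_right hr
  simp only [← map_mul, hij.ne, if_false, if_true] at key
  have e3 : -e - 0 + e = 0 := by ring
  have e4 : -1 - e - 0 + e = -1 := by ring
  rw [e3, e4] at key
  rw [hf]
  suffices E : pp x i j 0 * qq x i j (-1) * ρ *
      (pp x i j (-e) * qq x i j (-1 - e) * pp x i j (-1) * qq x i j 0) =
      pp x i j (-e) * qq x i j (-1 - e) * ρ by rw [E]; exact key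
  have e1 : pp x i j 0 * qq x i j 0 = 1 := pq x hu i j 0 hij.ne
  have e2 : pp x i j (-1) * qq x i j (-1) = 1 := pq x hu i j (-1) hij.ne
  linear_combination (pp x i j (-e) * qq x i j (-1 - e) * ρ * pp x i j (-1) * qq x i j (-1)) * e1
    + (pp x i j (-e) * qq x i j (-1 - e) * ρ) * e2

theorem gg_back {a : A} {j : Fin n} {e : ℤ} (hs : Shifts ι x a j e) (i : Fin n) (hij : i < j) :
    SemiconjBy a
      (ι (Ring.inverse (ff x i) *
        (qq x i j (-e) * pp x i j (-1 - e) * qq x i j (-1) * pp x i j 0)))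
      (ι (Ring.inverse (ff x i))) := by
  have U := fun m => hu i j m hij.ne
  have V := fun m => (hu i j m hij.ne).ringInverse
  have hd : IsUnit (ff x i * (pp x i j (-e) * qq x i j (-1 - e) * pp x i j (-1) * qq x i j 0)) :=
    (unit_ff x hu i).mul ((((U _).mul (V _)).mul (U _)).mul (V _))
  have := semi_inv ι hd (unit_ff x hu i) (ff_back ι x hu hs i hij)
  convert this using 2
  apply hd.mul_left_cancel
  rw [Ring.mul_inverse_cancel _ hd]
  have e0 := Ring.mul_inverse_cancel _ (unit_ff x hu i)
  have e1 : pp x i j (-e) * qq x i j (-e) = 1 := pq x hu i j (-e) hij.ne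
  have e2 : pp x i j (-1-e) * qq x i j (-1-e) = 1 := pq x hu i j (-1-e) hij.ne
  have e3 : pp x i j (-1) * qq x i j (-1) = 1 := pq x hu i j (-1) hij.ne
  have e4 : pp x i j 0 * qq x i j 0 = 1 := pq x hu i j 0 hij.ne
  calc _ = (ff x i * Ring.inverse (ff x i)) * (pp x i j (-e) * qq x i j (-e)) *
        (pp x i j (-1-e) * qq x i j (-1-e)) * (pp x i j (-1) * qq x i j (-1)) *
        (pp x i j 0 * qq x i j 0) := by ring
    _ = 1 := by rw [e0, e1, e2, e3, e4]; ring

theorem qq_swap (i j : Fin n) (m : ℤ) (hij : i ≠ j) : qq x j i (-m) = - qq x i j m := by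
  have h1 := pq x hu i j m hij
  have h2 := pq x hu j i (-m) hij.symm
  push_cast at h1 h2
  linear_combination (-qq x j i (-m)) * h1 - (qq x i j m) * h2

section rels

variable {Z D : Fin n → A} (hZ : ∀ j, Shifts ι x (Z j) j 1) (hD : ∀ j, Shifts ι x (D j) j (-1))

include hD in
theorem rel3 (i j : Fin n) (hij : i < j)
    (hDD : D i * D j = ι (pp x i j (-1) * qq x i j 0) * (D j * D i)) :
    D j * ι (Ring.inverse (ff x j)) * (D i * ι (Ring.inverse (ff x i))) =
      D i * ι (Ring.inverse (ff x i)) * (D j * ι (Ring.inverse (ff x j))) *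
        ι (qq x i j 0 * pp x i j 1) := by
  have a1 := (gg_comm ι x hu (hD i) j hij).eq
  have a2 := (gg_back ι x hu (hD j) i hij).eq
  have b1 := shifts_pp ι x (hD i) i j (-1)
  have b2 := shifts_qq ι x hu (hD i) i j 0 hij.ne
  have b3 := shifts_pp ι x (hD j) i j 0
  have b4 := shifts_qq ι x hu (hD j) i j 1 hij.ne
  simp only [hij.ne, hij.ne', if_true, if_false] at b1 b2 b3 b4
  norm_num at a2 b1 b2 b3 b4
  have c := ((b3.mul_right b4).mul_left (b1.mul_right b2)).eq
  rw [← map_mul] at c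
  have e1 : pp x i j 1 * qq x i j 1 = 1 := pq x hu i j 1 hij.ne
  have e2 : pp x i j (-1) * qq x i j (-1) = 1 := pq x hu i j (-1) hij.ne
  have e3 : pp x i j 0 * qq x i j 0 = 1 := pq x hu i j 0 hij.ne
  simp only [← map_mul] at a2
  generalize Ring.inverse (ff x i) = gi at *
  generalize Ring.inverse (ff x j) = gj at *
  calc D j * ι gj * (D i * ι gi) = D j * (ι gj * D i) * ι gi := by simp only [mul_assoc]
    _ = D j * D i * ι (gj * gi) := by rw [← a1, map_mul]; simp only [mul_assoc]
    _ = D j * D i * ι ((pp x i j (-1) * qq x i j 0) *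
          (gi * (qq x i j 1 * pp x i j 0 * qq x i j (-1) * pp x i j 0)) * gj *
          (qq x i j 0 * pp x i j 1)) := by
        congr 2
        symm
        calc _ = gj * gi * (pp x i j 1 * qq x i j 1) * (pp x i j (-1) * qq x i j (-1)) *
              (pp x i j 0 * qq x i j 0) * (pp x i j 0 * qq x i j 0) := by ring
          _ = gj * gi := by rw [e1, e2, e3]; ring
    _ = (D j * D i * ι (pp x i j (-1) * qq x i j 0)) *
          ι (gi * (qq x i j 1 * pp x i j 0 * qq x i j (-1) * pp x i j 0)) * ι gj *
          ι (qq x i j 0 * pp x i j 1) := by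
        rw [map_mul, map_mul, map_mul]; simp only [mul_assoc]
    _ = D i * (D j * ι (gi * (qq x i j 1 * pp x i j 0 * qq x i j (-1) * pp x i j 0))) * ι gj *
          ι (qq x i j 0 * pp x i j 1) := by
        rw [c, ← hDD]; simp only [mul_assoc]
    _ = _ := by rw [a2]; simp only [mul_assoc]

include hZ in
theorem rel4 (i j : Fin n) (hij : i < j)
    (hZZ : Z i * Z j = ι (pp x i j 1 * qq x i j 0) * (Z j * Z i)) :
    ι (ff x j) * Z j * (ι (ff x i) * Z i) =
      ι (ff x i) * Z i * (ι (ff x j) * Z j) * ι (qq x i j 0 * pp x i j (-1)) := by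
  have a1 := (ff_comm ι x hu (hZ i) j hij).eq
  have a2 := (ff_shift ι x hu (hZ j) i hij).eq
  have b1 := shifts_pp ι x (hZ i) i j 0
  have b2 := shifts_qq ι x hu (hZ i) i j 1 hij.ne
  have b3 := shifts_pp ι x (hZ j) i j (-1)
  have b4 := shifts_qq ι x hu (hZ j) i j 0 hij.ne
  simp only [hij.ne, hij.ne', if_true, if_false] at b1 b2 b3 b4
  norm_num at a2 b1 b2 b3 b4
  have c := ((b2.mul_right b1).mul_left (b4.mul_right b3)).eq
  simp only [← map_mul] at c
  simp only [← map_mul] at a2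
  have e3 : pp x i j 0 * qq x i j 0 = 1 := pq x hu i j 0 hij.ne
  generalize ff x i = gi at *
  generalize ff x j = gj at *
  calc ι gj * Z j * (ι gi * Z i) = ι gj * (Z j * ι gi) * Z i := by simp only [mul_assoc]
    _ = ι (gj * (gi * (pp x i j 1 * qq x i j 0 * pp x i j (-1) * qq x i j 0))) * (Z j * Z i) := by
        rw [a2, map_mul ι gj]; simp only [mul_assoc]
    _ = ι (gi * gj * (qq x i j 0 * pp x i j (-1)) * (pp x i j 1 * qq x i j 0)) * (Z j * Z i) := by
        congr 2; ring
    _ = ι (gi * gj) * (ι (qq x i j 0 * pp x i j (-1)) * (Z i * Z j)) := by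
        rw [hZZ, map_mul, map_mul]; simp only [mul_assoc]
    _ = ι gi * (ι gj * Z i) * Z j * ι (qq x i j 0 * pp x i j (-1)) := by
        rw [← c, map_mul]; simp only [mul_assoc]
    _ = _ := by rw [← a1]; simp only [mul_assoc]

include hZ hD in
theorem rel5 (i j : Fin n) (hij : i < j)
    (hZD : Z j * D i = ι (pp x i j 0 * pp x i j 2 * qq x i j 1 ^ 2) * (D i * Z j)) :
    ι (ff x j) * Z j * (D i * ι (Ring.inverse (ff x i))) =
      D i * ι (Ring.inverse (ff x i)) * (ι (ff x j) * Z j) := by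
  have a1 := (ff_comm ι x hu (hD i) j hij).eq
  have a2 := (gg_shift ι x hu (hZ j) i hij).eq
  have b1 := shifts_pp ι x (hD i) i j (-1)
  have b2 := shifts_pp ι x (hD i) i j 1
  have b3 := shifts_qq ι x hu (hD i) i j 0 hij.ne
  simp only [hij.ne, hij.ne', if_true, if_false] at b1 b2 b3
  norm_num at a2 b1 b2 b3
  have c := ((b1.mul_right b2).mul_right (b3.pow_right 2)).eq
  simp only [← map_mul, ← map_pow] at c
  simp only [← map_mul] at a2
  have e1 : pp x i j 1 * qq x i j 1 = 1 := pq x hu i j 1 hij.ne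
  have e2 : pp x i j (-1) * qq x i j (-1) = 1 := pq x hu i j (-1) hij.ne
  have e3 : pp x i j 0 * qq x i j 0 = 1 := pq x hu i j 0 hij.ne
  generalize Ring.inverse (ff x i) = gi at *
  generalize ff x j = gj at *
  calc ι gj * Z j * (D i * ι gi) = ι gj * (Z j * D i) * ι gi := by simp only [mul_assoc]
    _ = ι gj * (D i * ι (pp x i j (-1) * pp x i j 1 * qq x i j 0 ^ 2)) * (Z j * ι gi) := by
        rw [hZD, c]; simp only [mul_assoc]
    _ = ι gj * D i * ι ((pp x i j (-1) * pp x i j 1 * qq x i j 0 ^ 2) *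
          (gi * (qq x i j 1 * pp x i j 0 * qq x i j (-1) * pp x i j 0))) * Z j := by
        rw [a2, map_mul ι (pp x i j (-1) * pp x i j 1 * qq x i j 0 ^ 2)]; simp only [mul_assoc]
    _ = ι gj * D i * ι gi * Z j := by
        congr 3
        calc _ = gi * (pp x i j 1 * qq x i j 1) * (pp x i j (-1) * qq x i j (-1)) *
              (pp x i j 0 * qq x i j 0) * (pp x i j 0 * qq x i j 0) := by ring
          _ = gi := by rw [e1, e2, e3]; ring
    _ = D i * ι (gi * gj) * Z j := by
        rw [← a1, mul_comm gi, map_mul]; simp only [mul_assoc]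
    _ = _ := by rw [map_mul]; simp only [mul_assoc]

include hZ hD in
theorem rel6 (i j : Fin n) (hji : j < i) (hZD : Z j * D i = D i * Z j) :
    ι (ff x j) * Z j * (D i * ι (Ring.inverse (ff x i))) =
      D i * ι (Ring.inverse (ff x i)) * (ι (ff x j) * Z j) *
        ι (qq x j i 1 ^ 2 * (pp x j i 2 * pp x j i 0)) := by
  have a1 := (gg_comm ι x hu (hZ j) i hji).eq
  have a2 := (ff_back ι x hu (hD i) j hji).eq
  have b1 := shifts_qq ι x hu (hZ j) j i 1 hji.ne
  have b2 := shifts_pp ι x (hZ j) j i 2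
  have b3 := shifts_pp ι x (hZ j) j i 0
  simp only [hji.ne, hji.ne', if_true, if_false] at b1 b2 b3
  norm_num at a2 b1 b2 b3
  have c := ((b1.pow_right 2).mul_right (b2.mul_right b3)).eq
  simp only [← map_mul, ← map_pow] at c
  simp only [← map_mul] at a2
  generalize Ring.inverse (ff x i) = gi at *
  generalize ff x j = gj at *
  calc ι gj * Z j * (D i * ι gi) = ι gj * (Z j * D i) * ι gi := by simp only [mul_assoc]
    _ = (ι gj * D i) * (Z j * ι gi) := by rw [hZD]; simp only [mul_assoc]
    _ = D i * ι (gj * (pp x j i 1 * qq x j i 0 * pp x j i (-1) * qq x j i 0) * gi) * Z j := by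
        rw [← a2, a1, map_mul _ _ gi]; simp only [mul_assoc]
    _ = D i * ι (gi * gj * (qq x j i 0 ^ 2 * (pp x j i 1 * pp x j i (-1)))) * Z j := by
        congr 3; ring
    _ = D i * ι gi * ι gj * (ι (qq x j i 0 ^ 2 * (pp x j i 1 * pp x j i (-1))) * Z j) := by
        rw [map_mul, map_mul ι gi]; simp only [mul_assoc]
    _ = _ := by rw [← c]; simp only [mul_assoc]

end rels

end core

theorem stmt12 {k A : Type*} [Field k] [CharZero k] [Ring A] [Algebra k A]
    {n : ℕ} (hn : 1 ≤ n) (h Z D : Fin n → A)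
    (hcomm : ∀ i j, h i * h j = h j * h i)
    (hunit : ∀ (i j : Fin n) (m : ℤ), i ≠ j → IsUnit (h i - h j + (m : A)))
    (hhZ : ∀ i j, h i * Z j = Z j * (h i + if i = j then 1 else 0))
    (hhD : ∀ i j, h i * D j = D j * (h i - if i = j then 1 else 0))
    (hZZ : ∀ i j, i < j →
      Z i * Z j = (h i - h j + 1) * Ring.inverse (h i - h j) * (Z j * Z i))
    (hDD : ∀ i j, i < j →
      D i * D j = (h i - h j - 1) * Ring.inverse (h i - h j) * (D j * D i))
    (hZD : ∀ i j, i < j → Z i * D j = D j * Z i)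
    (hZD' : ∀ i j, j < i → Z i * D j =
      (h i - h j) * (h i - h j - 2) * (Ring.inverse (h i - h j - 1)) ^ 2 * (D j * Z i))
    (hZDdiag : ∀ i, Z i * D i =
      (∑ j, Ring.inverse (1 - (h i - h j)) * (D j * Z j)) - 1) :
    ∀ h' Z' D' : Fin n → Aᵐᵒᵖ,
      h' = (fun i => MulOpposite.op (h i)) →
      Z' = (fun i => MulOpposite.op (D i * Ring.inverse
            (oprod (Finset.univ.filter fun m => i < m)
              (fun m => (h i - h m) * Ring.inverse (h i - h m - 1))))) →
      D' = (fun i => MulOpposite.op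
            (oprod (Finset.univ.filter fun m => i < m)
              (fun m => (h i - h m) * Ring.inverse (h i - h m - 1)) * Z i)) →
      (∀ i j, h' i * Z' j = Z' j * (h' i + if i = j then 1 else 0)) ∧
      (∀ i j, h' i * D' j = D' j * (h' i - if i = j then 1 else 0)) ∧
      (∀ i j, i < j → Z' i * Z' j =
        (h' i - h' j + 1) * Ring.inverse (h' i - h' j) * (Z' j * Z' i)) ∧
      (∀ i j, i < j → D' i * D' j =
        (h' i - h' j - 1) * Ring.inverse (h' i - h' j) * (D' j * D' i)) ∧
      (∀ i j, i < j → Z' i * D' j = D' j * Z' i) ∧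
      (∀ i j, j < i → Z' i * D' j =
        (h' i - h' j) * (h' i - h' j - 2) * (Ring.inverse (h' i - h' j - 1)) ^ 2 * (D' j * Z' i)) ∧
      (∀ i, Z' i * D' i = (∑ j, Ring.inverse (1 - (h' i - h' j)) * (D' j * Z' j)) - 1) := by
  obtain ⟨C, hC, ι, x, hx, hr, hcen⟩ := exists_comm_model h hcomm
  have hp : ∀ i j (m : ℤ), ι (pp x i j m) = h i - h j + (m : A) := by
    intro i j m; simp [pp, hx]
  have hu : ∀ (i j : Fin n) (m : ℤ), i ≠ j → IsUnit (pp x i j m) := by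
    intro i j m hij
    apply hr
    rw [hp]
    exact hunit i j m hij
  have hq : ∀ i j (m : ℤ), i ≠ j → Ring.inverse (h i - h j + (m : A)) = ι (qq x i j m) := by
    intro i j m hij
    rw [qq, map_ringInverse ι (hu i j m hij), hp]
  have hZ : ∀ j, Shifts ι x (Z j) j 1 := by
    intro j i
    have := hhZ i j
    unfold SemiconjBy
    rw [map_sub, hx]
    split_ifs at this ⊢ <;> simp [mul_add, sub_mul] at this ⊢
    · rw [this]; simp
    · rw [this]
  have hD : ∀ j, Shifts ι x (D j) j (-1) := by
    intro j i
    have := hhD i j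
    unfold SemiconjBy
    rw [map_sub, hx]
    split_ifs at this ⊢ <;> simp [mul_sub, add_mul] at this ⊢
    · rw [this]; simp
    · rw [this]
  have hphi : ∀ i, oprod (Finset.univ.filter fun m => i < m)
      (fun m => (h i - h m) * Ring.inverse (h i - h m - 1)) = ι (ff x i) := by
    intro i
    rw [ff, ← oprod_map]
    congr 1
    funext m
    have hum : IsUnit (pp x i m (-1)) := by
      by_cases him : i = m
      · subst him
        simp [pp]
      · exact hu i m _ him
    rw [map_mul, qq, map_ringInverse ι hum, hp, hp]
    simp [sub_eq_add_neg]
  have hpsi : ∀ i, Ring.inverse (ι (ff x i)) = ι (Ring.inverse (ff x i)) := fun i =>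
    (map_ringInverse ι (unit_ff x hu i)).symm
  have p0 : ∀ i j, h i - h j = ι (pp x i j 0) := by intro i j; simp [hp]
  have p1 : ∀ i j, h i - h j + 1 = ι (pp x i j 1) := by intro i j; simp [hp]
  have pm1 : ∀ i j, h i - h j - 1 = ι (pp x i j (-1)) := by intro i j; simp [hp, sub_eq_add_neg]
  have pm2 : ∀ i j, h i - h j - 2 = ι (pp x i j (-2)) := by intro i j; simp [hp, sub_eq_add_neg]
  have q0 : ∀ i j, i ≠ j → Ring.inverse (h i - h j) = ι (qq x i j 0) := by
    intro i j hij; simpa using hq i j 0 hij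
  have qm1 : ∀ i j, i ≠ j → Ring.inverse (h i - h j - 1) = ι (qq x i j (-1)) := by
    intro i j hij; simpa [sub_eq_add_neg] using hq i j (-1) hij
  have sw0 : ∀ i j, pp x j i 0 = - pp x i j 0 := by intro i j; simp [pp]
  have sw2 : ∀ i j, pp x j i (-2) = - pp x i j 2 := by intro i j; simp [pp]; ring
  have u0 : ∀ i j, i ≠ j → IsUnit (h i - h j) := by
    intro i j hij; simpa using hunit i j 0 hij
  have um1 : ∀ i j, i ≠ j → IsUnit (h i - h j - 1) := by
    intro i j hij; simpa [sub_eq_add_neg] using hunit i j (-1) hij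
  have uone : ∀ i j, IsUnit (1 - (h i - h j)) := by
    intro i j
    by_cases hij : i = j
    · subst hij; simp
    · have := hunit j i 1 (Ne.symm hij)
      convert this using 1
      push_cast; abel
  have cDZ : ∀ i j, Commute (D j * Z j) (h i) := by
    intro i j
    have h1 := hhD i j
    have h2 := hhZ i j
    unfold Commute SemiconjBy
    rw [← mul_assoc, h1, mul_assoc (D j), mul_assoc (D j), sub_mul, h2]
    split_ifs <;> simp [mul_add, mul_assoc]
  have cZD : ∀ i j, Commute (Z j * D j) (h i) := by
    intro i j
    have h1 := hhD i j
    have h2 := hhZ i j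
    unfold Commute SemiconjBy
    rw [← mul_assoc, h2, mul_assoc (Z j), mul_assoc (Z j), add_mul, h1]
    split_ifs <;> simp [mul_sub, mul_assoc]
  rintro h' Z' D' rfl rfl rfl
  simp only [hphi, hpsi]
  refine ⟨?_, ?_, ?_, ?_, ?_, ?_, ?_⟩
  · intro i j
    apply MulOpposite.unop_injective
    have h1 := hhD i j
    have h2 : Commute (h i) (ι (Ring.inverse (ff x j))) := hcen _ (fun l => hcomm i l) _
    split_ifs at h1 ⊢ <;> simp [mul_sub, add_mul, mul_assoc] at h1 ⊢
    · rw [← h2.eq, ← mul_assoc, ← mul_assoc, h1]; simp [sub_mul]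
    · rw [← h2.eq, ← mul_assoc, ← mul_assoc, h1]
  · intro i j
    apply MulOpposite.unop_injective
    have h1 := hhZ i j
    have h2 : Commute (h i) (ι (ff x j)) := hcen _ (fun l => hcomm i l) _
    split_ifs at h1 ⊢ <;> simp [mul_add, sub_mul, mul_assoc] at h1 ⊢
    · rw [← mul_assoc (h i), h2.eq, mul_assoc, h1]; simp [mul_add]
    · rw [← mul_assoc (h i), h2.eq, mul_assoc, h1]
  · intro i j hij
    apply MulOpposite.unop_injective
    rw [← MulOpposite.op_sub, op_ringInverse (u0 i j hij.ne)]
    simp only [MulOpposite.unop_mul, MulOpposite.unop_op, MulOpposite.unop_add,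
      MulOpposite.unop_one]
    rw [q0 i j hij.ne, p1, ← map_mul]
    apply rel3 ι x hu hD i j hij
    rw [hDD i j hij, q0 i j hij.ne, pm1, map_mul]
  · intro i j hij
    apply MulOpposite.unop_injective
    rw [← MulOpposite.op_sub, op_ringInverse (u0 i j hij.ne)]
    simp only [MulOpposite.unop_mul, MulOpposite.unop_op, MulOpposite.unop_sub,
      MulOpposite.unop_one]
    rw [q0 i j hij.ne, pm1, ← map_mul]
    apply rel4 ι x hu hZ i j hij
    rw [hZZ i j hij, q0 i j hij.ne, p1, map_mul]
  · intro i j hij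
    apply MulOpposite.unop_injective
    simp only [MulOpposite.unop_mul, MulOpposite.unop_op]
    apply rel5 ι x hu hZ hD i j hij
    rw [hZD' j i hij, qm1 j i hij.ne', pm2, p0, ← map_mul, ← map_pow, ← map_mul,
      qq_swap x hu i j 1 hij.ne, sw0 i j, sw2 i j]
    congr 2
    ring
  · intro i j hji
    apply MulOpposite.unop_injective
    rw [← MulOpposite.op_sub, ← MulOpposite.op_one, ← MulOpposite.op_sub,
      op_ringInverse (um1 i j hji.ne')]
    have t2 : (2 : Aᵐᵒᵖ) = MulOpposite.op 2 := rfl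
    rw [t2]
    simp only [MulOpposite.unop_mul, MulOpposite.unop_op, MulOpposite.unop_sub,
      MulOpposite.unop_pow]
    rw [rel6 ι x hu hZ hD i j hji (hZD j i hji), qm1 i j hji.ne', pm2, p0, ← map_mul, ← map_pow,
      ← map_mul, qq_swap x hu j i 1 hji.ne, sw0 j i, sw2 j i]
    congr 2
    ring
  · intro i
    apply MulOpposite.unop_injective
    have hF : Commute (Z i * D i) (ι (ff x i)) := hcen _ (fun l => cZD l i) _
    have hinv : ∀ l, ι (Ring.inverse (ff x l)) * ι (ff x l) = 1 := by
      intro l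
      rw [← map_mul, Ring.inverse_mul_cancel _ (unit_ff x hu l), map_one]
    have hinv' : ∀ l, ι (ff x l) * ι (Ring.inverse (ff x l)) = 1 := by
      intro l
      rw [← map_mul, Ring.mul_inverse_cancel _ (unit_ff x hu l), map_one]
    simp only [← MulOpposite.op_sub, ← MulOpposite.op_one, op_ringInverse (uone i _),
      ← MulOpposite.op_mul, MulOpposite.unop_sub, Finset.unop_sum, MulOpposite.unop_op]
    calc ι (ff x i) * Z i * (D i * ι (Ring.inverse (ff x i)))
        = ι (ff x i) * (Z i * D i) * ι (Ring.inverse (ff x i)) := by simp only [mul_assoc]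
      _ = Z i * D i := by rw [← hF.eq, mul_assoc, hinv', mul_one]
      _ = _ := by
        rw [hZDdiag i]
        congr 1
        apply Finset.sum_congr rfl
        intro j _
        have e1 : D j * ι (Ring.inverse (ff x j)) * (ι (ff x j) * Z j) = D j * Z j := by
          rw [mul_assoc, ← mul_assoc (ι _) (ι _), hinv, one_mul]
        rw [e1]
        have e2 : 1 - (h i - h j) = ι (pp x j i 1) := by rw [hp]; push_cast; abel
        have e3 : IsUnit (pp x j i 1) := by apply hr; rw [← e2]; exact uone i j
        rw [e2, ← map_ringInverse ι e3]
        exact (hcen _ (fun l => cDZ l j) _).eq.symm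
end
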